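/- arXiv:1112.0956 — 3 statements merged into one kernel-verified Lean document; each statement's English description precedes it below -/
import Mathlib

section
/- Let F be a field, n a positive integer, and A an n×n matrix over F. Suppose λ₁,…,λ_r ∈ F and n₁,…,n_r are positive integers with n₁+⋯+n_r = n, and suppose there exist matrices P(λ), Q(λ) with entries in the polynomial ring F[λ] that are invertible over F[λ] (i.e., units of the matrix ring over F[λ]) such that P(λ)·(λ·E − A)·Q(λ) equals the n×n diagonal matrix whose first n − r diagonal entries are 1 and whose last r diagonal entries are (λ−λ₁)^{n₁}, …, (λ−λ_r)^{n_r}. Then A is similar over F to the block diagonal matrix diag(J_{λ₁,n₁}, …, J_{λ_r,n_r}), where J_{λ_i,n_i} denotes the n_i×n_i Jordan block with eigenvalue λ_i. -/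
open Polynomial Matrix

/-- The Jordan block of size `m` with eigenvalue `μ`: `μ` on the diagonal,
`1` on the superdiagonal, `0` elsewhere. -/
def jordanBlock {F : Type*} [Field F] (μ : F) (m : ℕ) : Matrix (Fin m) (Fin m) F :=
  fun i j => if (j : ℕ) = (i : ℕ) then μ else if (j : ℕ) = (i : ℕ) + 1 then 1 else 0

/-- A left factor `P` of a diagonalization `P (X - A) Q = diag d` of the characteristic matrix
provides vectors `w i`, annihilated by `d i`, that generate the module under the action of `A`. -/
theorem exists_generators_of_charmatrix_diagonalization {R ι : Type*} [CommRing R] [Fintype ι]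
    [DecidableEq ι] (A : Matrix ι ι R) (P Q : Matrix ι ι R[X]) (hP : IsUnit P) (d : ι → R[X])
    (hPQ : P * charmatrix A * Q = Matrix.diagonal d) :
    ∃ w : ι → ι → R, (∀ i, aeval A.mulVecLin (d i) (w i) = 0) ∧
      ∀ N : Submodule R (ι → R), (∀ v ∈ N, A *ᵥ v ∈ N) → (∀ i, w i ∈ N) → N = ⊤ := by
  obtain ⟨U, rfl⟩ := hP
  let T : Matrix ι ι R[X] := ↑U⁻¹
  have hT : T * U = 1 := U.inv_mul
  let φ : (ι → R[X]) →ₗ[R[X]] Module.AEval' A.mulVecLin :=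
    Fintype.linearCombination R[X] fun j => Module.AEval'.of A.mulVecLin (Pi.single j 1)
  have hφ (v : ι → R[X]) :
      φ v = ∑ j, v j • Module.AEval'.of A.mulVecLin (Pi.single j 1) := rfl
  have hφA (j : ι) : φ (charmatrix A *ᵥ Pi.single j 1) = 0 := by
    have hX : (X : R[X]) • Module.AEval'.of A.mulVecLin (Pi.single j 1) =
        ∑ i, C (A i j) • Module.AEval'.of A.mulVecLin (Pi.single i 1) := by
      rw [Module.AEval'.X_smul_of]
      simp only [Module.AEval.C_smul, ← map_smul, ← map_sum]
      congr 1
      ext i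
      simp [Finset.sum_apply, Pi.single_apply]
    simp [hφ, charmatrix, sub_smul, Finset.sum_sub_distrib, Matrix.scalar_apply,
      Matrix.diagonal_apply, hX, ite_smul]
  have hφM (v : ι → R[X]) : φ (charmatrix A *ᵥ v) = 0 := by
    have : φ ∘ₗ (charmatrix A).mulVecLin = 0 := by
      ext j
      simpa using hφA j
    exact LinearMap.congr_fun this v
  refine ⟨fun i => (Module.AEval'.of A.mulVecLin).symm (φ (T *ᵥ Pi.single i 1)), fun i => ?_,
    fun N hN hw => ?_⟩
  · have hM : charmatrix A *ᵥ (Q *ᵥ Pi.single i 1) = d i • (T *ᵥ Pi.single i 1) := by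
      have h : charmatrix A * Q = T * Matrix.diagonal d := by
        rw [← hPQ, ← mul_assoc, ← mul_assoc, hT, one_mul]
      rw [Matrix.mulVec_mulVec, h, ← Matrix.mulVec_mulVec, ← Matrix.mulVec_smul]
      congr 1
      ext j : 1
      obtain rfl | h := eq_or_ne j i <;> simp [Matrix.mulVec_diagonal, *]
    rw [← Module.End.smul_def, ← Module.AEval.of_symm_smul, ← map_smul, ← hM, hφM, map_zero]
  · refine eq_top_iff.2 fun y _ => ?_
    have hy : Module.AEval'.of A.mulVecLin y = φ fun j => C (y j) := by
      simp only [hφ, Module.AEval.C_smul, ← map_smul, ← map_sum]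
      congr 1
      ext i
      simp [Finset.sum_apply, Pi.single_apply]
    have hu : (fun j => C (y j)) = ∑ i, ((U : Matrix ι ι R[X]) *ᵥ fun j => C (y j)) i •
        (T *ᵥ Pi.single i 1) := by
      simp only [← Matrix.mulVec_smul, ← Matrix.mulVec_sum, ← pi_eq_sum_univ']
      rw [Matrix.mulVec_mulVec, hT, Matrix.one_mulVec]
    rw [← (Module.AEval'.of A.mulVecLin).symm_apply_apply y, hy, hu]
    simp only [map_sum, map_smul, Module.AEval.of_symm_smul]
    exact sum_mem fun i _ => aeval_apply_smul_mem_of_le_comap (hw i) _ _ hN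

/-- On the chain `(f - μ) ^ (m - 1 - s) w`, where `(f - μ) ^ m` kills `w`, the endomorphism `f`
acts through the Jordan block. -/
theorem sum_jordanBlock_smul_pow_apply {F V : Type*} [Field F] [AddCommGroup V] [Module F V]
    (f : Module.End F V) (μ : F) (m : ℕ) (w : V) (hw : ((f - algebraMap F _ μ) ^ m) w = 0)
    (c : Fin m) :
    ∑ s : Fin m, jordanBlock μ m s c • ((f - algebraMap F _ μ) ^ (m - 1 - (s : ℕ))) w =
      f (((f - algebraMap F _ μ) ^ (m - 1 - (c : ℕ))) w) := by
  set g := f - algebraMap F _ μ with hg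
  have hf (v : V) : f v = μ • v + g v := by simp [hg, Module.algebraMap_end_apply]
  rw [hf, ← Module.End.mul_apply, ← pow_succ']
  obtain ⟨c, hc⟩ := c
  obtain _ | c := c
  · rw [Finset.sum_eq_single ⟨0, hc⟩]
    · have : m - 1 + 1 = m := by omega
      simp [jordanBlock, this, hw]
    · intro s _ hs
      have : (0 : ℕ) ≠ s := fun h => hs (Fin.ext h.symm)
      simp [jordanBlock, this]
    · simp
  · rw [← Finset.sum_subset (Finset.subset_univ {⟨c + 1, hc⟩, ⟨c, by omega⟩}),
      Finset.sum_pair (by simp)]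
    · have : m - 1 - (c + 1) + 1 = m - 1 - c := by omega
      simp [jordanBlock, this]
    · intro s _ hs
      have h1 : c + 1 ≠ s := fun h => hs (by simp [Fin.ext_iff, h])
      have h2 : c ≠ s := fun h => hs (by simp [Fin.ext_iff, h])
      simp [jordanBlock, h1, h2]

/-- **Theorem 1 (Jordan).** If the characteristic matrix `λE - A` of `A ∈ Mₙ(F)` can be
brought, by multiplication on the left and right by matrices invertible over `F[λ]`, to the
diagonal matrix whose first `n - r` diagonal entries are `1` and whose last `r` diagonal
entries are `(λ - λ₁)^{n₁}, …, (λ - λᵣ)^{nᵣ}` (with `n₁ + ⋯ + nᵣ = n`), then `A` is similar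
over `F` to the block diagonal matrix `diag(J_{λ₁,n₁}, …, J_{λᵣ,nᵣ})`. -/
theorem jordan_normal_form_of_smith_form
    {F : Type*} [Field F] {n : ℕ} (hn : 0 < n) (A : Matrix (Fin n) (Fin n) F)
    (r : ℕ) (Λ : Fin r → F) (k : Fin r → ℕ) (hk : ∀ i, 0 < k i)
    (hsum : ∑ i, k i = n)
    (P Q : Matrix (Fin n) (Fin n) F[X])
    (hP : IsUnit P) (hQ : IsUnit Q)
    (d : Fin n → F[X])
    (hd1 : ∀ i : Fin n, (i : ℕ) < n - r → d i = 1)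
    (hd2 : ∀ j : Fin r, ∀ i : Fin n, (i : ℕ) = n - r + (j : ℕ) →
      d i = (X - C (Λ j)) ^ (k j))
    (hPQ : P * charmatrix A * Q = Matrix.diagonal d) :
    ∃ e : (Σ i : Fin r, Fin (k i)) ≃ Fin n,
      ∃ S : Matrix (Fin n) (Fin n) F, IsUnit S ∧
        A = S * (Matrix.reindex e e
          (Matrix.blockDiagonal' (fun i => jordanBlock (Λ i) (k i)))) * S⁻¹ := by
  have hr : r ≤ n := by
    simpa [hsum] using Finset.card_nsmul_le_sum Finset.univ k 1 fun i _ => hk i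
  obtain ⟨w, hw, hgen⟩ := exists_generators_of_charmatrix_diagonalization A P Q hP d hPQ
  let idx (j : Fin r) : Fin n := ⟨n - r + j, by omega⟩
  let f : Module.End F (Fin n → F) := A.mulVecLin
  let g (j : Fin r) : Module.End F (Fin n → F) := f - algebraMap F _ (Λ j)
  have hg (j : Fin r) : (g j ^ k j) (w (idx j)) = 0 := by
    have := hw (idx j)
    rw [hd2 j (idx j) rfl] at this
    simpa [g, f] using this
  let b (x : Σ i : Fin r, Fin (k i)) : Fin n → F := (g x.1 ^ (k x.1 - 1 - x.2)) (w (idx x.1))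
  let e : (Σ i : Fin r, Fin (k i)) ≃ Fin n := Fintype.equivFinOfCardEq (by simp [hsum])
  let S : Matrix (Fin n) (Fin n) F := Matrix.of fun i x => b (e.symm x) i
  let J := Matrix.blockDiagonal' fun i => jordanBlock (Λ i) (k i)
  have hAS : A * S = S * Matrix.reindex e e J := by
    ext i x
    obtain ⟨⟨j, c⟩, rfl⟩ := e.surjective x
    have h := congrFun (sum_jordanBlock_smul_pow_apply f (Λ j) (k j) (w (idx j)) (hg j) c) i
    have hl : (A * S) i (e ⟨j, c⟩) = f (b ⟨j, c⟩) i := by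
      simp [S, f, Matrix.mul_apply, Matrix.mulVec, dotProduct]
    rw [hl, Matrix.mul_apply, ← e.sum_comp, Fintype.sum_sigma, Fintype.sum_eq_single j]
    · rw [← h]
      rw [Finset.sum_apply]
      refine Finset.sum_congr rfl fun s _ => ?_
      simp only [S, Matrix.of_apply, Equiv.symm_apply_apply]
      simp [J, b, g, mul_comm]
    · intro j' hj
      simp [J, Matrix.blockDiagonal'_apply_ne _ _ _ hj]
  have hcol (x) : b x ∈ LinearMap.range S.mulVecLin :=
    ⟨Pi.single (e x) 1, by ext i; simp [S]⟩
  have hS : IsUnit S := by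
    rw [← Matrix.mulVec_surjective_iff_isUnit]
    refine LinearMap.range_eq_top.1 (hgen (LinearMap.range S.mulVecLin) ?_ fun i => ?_)
    · rintro _ ⟨v, rfl⟩
      exact ⟨Matrix.reindex e e J *ᵥ v, by simp [Matrix.mulVec_mulVec, hAS]⟩
    · by_cases hi : (i : ℕ) < n - r
      · have := hw i
        rw [hd1 i hi, map_one, Module.End.one_apply] at this
        simp [this]
      · have hj : idx ⟨i - (n - r), by omega⟩ = i := Fin.ext (by simp [idx]; omega)
        have h := hcol ⟨⟨i - (n - r), by omega⟩, ⟨k _ - 1, Nat.sub_lt (hk _) one_pos⟩⟩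
        simpa [b, hj] using h
  refine ⟨e, S, hS, ?_⟩
  rw [← hAS, Matrix.mul_nonsing_inv_cancel_right _ _ ((Matrix.isUnit_iff_isUnit_det S).1 hS)]
end

section
/- Let F be a field, n a positive integer, and A an n×n matrix over F. Suppose g₁(λ), …, g_r(λ) ∈ F[λ] are monic polynomials, g_i(λ) = λ^{n_i} − a_{i,n_i−1}λ^{n_i−1} − ⋯ − a_{i,1}λ − a_{i,0}, with n₁+⋯+n_r = n, and suppose there exist matrices P(λ), Q(λ) with entries in F[λ] that are invertible over F[λ] such that P(λ)·(λ·E − A)·Q(λ) equals the n×n diagonal matrix whose first n − r diagonal entries are 1 and whose last r diagonal entries are g₁(λ), …, g_r(λ). Then A is similar over F to the block diagonal matrix diag(T₁, …, T_r), where T_i is the n_i×n_i companion-type matrix with 1 on the superdiagonal, last row (a_{i,0}, a_{i,1}, …, a_{i,n_i−1}), and 0 elsewhere. -/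
open Polynomial Matrix

/-- The "rational block" of size `m` attached to coefficients `a 0, …, a (m-1)`:
`1` on the superdiagonal, last row `(a 0, a 1, …, a (m-1))`, and `0` elsewhere
(the transposed companion matrix of `λ^m - a_{m-1} λ^{m-1} - ⋯ - a_1 λ - a_0`). -/
def rationalBlock {F : Type*} [Field F] {m : ℕ} (a : Fin m → F) :
    Matrix (Fin m) (Fin m) F :=
  fun i j => if (j : ℕ) = (i : ℕ) + 1 then 1
    else if (i : ℕ) = m - 1 then a j else 0

section RowEval

variable {F ι : Type*} [Field F] [Fintype ι] [DecidableEq ι]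

/-- The `F`-linear map `F[X]^ι → F^ι` sending a row vector `v` of polynomials to
`∑ i, eᵢ ᵥ* vᵢ(A)`. -/
noncomputable def rowEval (A : Matrix ι ι F) : (ι → F[X]) →ₗ[F] (ι → F) where
  toFun v j := ∑ i, (aeval A (v i)) i j
  map_add' v w := by
    ext j
    simp [Finset.sum_add_distrib]
  map_smul' c v := by
    ext j
    simp [Finset.mul_sum]

theorem rowEval_apply (A : Matrix ι ι F) (v : ι → F[X]) (j : ι) :
    rowEval A v j = ∑ i, (aeval A (v i)) i j := rfl

theorem rowEval_smul (A : Matrix ι ι F) (p : F[X]) (v : ι → F[X]) :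
    rowEval A (p • v) = rowEval A v ᵥ* aeval A p := by
  ext j
  simp only [rowEval_apply, Pi.smul_apply, smul_eq_mul, mul_comm p, map_mul, Matrix.mul_apply,
    vecMul, dotProduct, Finset.sum_mul]
  exact Finset.sum_comm

theorem rowEval_X_smul (A : Matrix ι ι F) (v : ι → F[X]) :
    rowEval A ((X : F[X]) • v) = rowEval A v ᵥ* A := by
  rw [rowEval_smul, aeval_X]

theorem rowEval_C (A : Matrix ι ι F) (w : ι → F) : rowEval A (fun i => C (w i)) = w := by
  ext j
  simp [rowEval_apply, Matrix.algebraMap_matrix_apply]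

theorem vecMul_charmatrix (A : Matrix ι ι F) (v : ι → F[X]) :
    v ᵥ* charmatrix A = (X : F[X]) • v - v ᵥ* A.map C := by
  ext1 j
  simp [charmatrix, vecMul_sub, mul_comm]

theorem rowEval_vecMul_map_C (A : Matrix ι ι F) (v : ι → F[X]) :
    rowEval A (v ᵥ* A.map C) = rowEval A v ᵥ* A := by
  ext l
  have h (i : ι) : (aeval A (v i) * A) i l = (A * aeval A (v i)) i l := by
    have := congrArg (fun p : F[X] => aeval A p i l) (mul_comm (v i) X)
    simpa using this
  simp only [rowEval_apply, vecMul, dotProduct, Finset.sum_mul, map_sum, map_mul, aeval_C,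
    Matrix.map_apply, Matrix.sum_apply]
  rw [Finset.sum_comm]
  conv_rhs => rw [Finset.sum_comm]
  refine Finset.sum_congr rfl fun i _ => ?_
  rw [← Matrix.mul_apply, h, Matrix.mul_apply]
  refine Finset.sum_congr rfl fun j _ => ?_
  rw [← Algebra.commutes, ← Algebra.smul_def, Matrix.smul_apply, smul_eq_mul]

theorem rowEval_vecMul_charmatrix (A : Matrix ι ι F) (v : ι → F[X]) :
    rowEval A (v ᵥ* charmatrix A) = 0 := by
  rw [vecMul_charmatrix, map_sub, rowEval_X_smul, rowEval_vecMul_map_C, sub_self]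

theorem sub_C_rowEval_mem_range (A : Matrix ι ι F) (v : ι → F[X]) :
    v - (fun i => C (rowEval A v i)) ∈ LinearMap.range (charmatrix A).vecMulLinear := by
  have hadd (v w : ι → F[X])
      (hv : v - (fun i => C (rowEval A v i)) ∈ LinearMap.range (charmatrix A).vecMulLinear)
      (hw : w - (fun i => C (rowEval A w i)) ∈ LinearMap.range (charmatrix A).vecMulLinear) :
      v + w - (fun i => C (rowEval A (v + w) i)) ∈
        LinearMap.range (charmatrix A).vecMulLinear := by
    convert add_mem hv hw using 1
    ext1 i
    simp only [map_add, Pi.add_apply, Pi.sub_apply]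
    ring
  have hX (v : ι → F[X])
      (hv : v - (fun i => C (rowEval A v i)) ∈ LinearMap.range (charmatrix A).vecMulLinear) :
      (X : F[X]) • v - (fun i => C (rowEval A ((X : F[X]) • v) i)) ∈
        LinearMap.range (charmatrix A).vecMulLinear := by
    convert add_mem (Submodule.smul_mem _ (X : F[X]) hv)
      (LinearMap.mem_range_self (charmatrix A).vecMulLinear
        (fun i => C (rowEval A v i))) using 1
    ext1 i
    simp [vecMul_charmatrix, rowEval_X_smul, vecMul, dotProduct, mul_sub]
  induction v using Pi.single_induction with
  | zero =>
    have h : (0 : ι → F[X]) - (fun i => C (rowEval A 0 i)) = 0 := by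
      ext1 i
      simp
    rw [h]
    exact Submodule.zero_mem _
  | add v w hv hw => exact hadd v w hv hw
  | single i p =>
    induction p using Polynomial.induction_on with
    | C c =>
      have h : (Pi.single i (C c) : ι → F[X]) = fun l => C ((Pi.single i c : ι → F) l) := by
        ext1 l
        rcases eq_or_ne l i with rfl | hl <;> simp [*]
      rw [h, rowEval_C, sub_self]
      exact Submodule.zero_mem _
    | add p q hp hq =>
      rw [Pi.single_add]
      exact hadd _ _ hp hq
    | monomial m c h =>
      have : (Pi.single i (C c * X ^ (m + 1)) : ι → F[X]) =
          (X : F[X]) • Pi.single i (C c * X ^ m) := by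
        rw [← Pi.single_smul, smul_eq_mul]
        congr 1
        ring
      rw [this]
      exact hX _ h

/-- The kernel of `rowEval A` is the row space of `charmatrix A`. -/
theorem rowEval_eq_zero_iff (A : Matrix ι ι F) (v : ι → F[X]) :
    rowEval A v = 0 ↔ ∃ u, u ᵥ* charmatrix A = v := by
  refine ⟨fun h => ?_, ?_⟩
  · obtain ⟨u, hu⟩ := sub_C_rowEval_mem_range A v
    refine ⟨u, hu.trans ?_⟩
    ext1 i
    simp [h]
  · rintro ⟨u, rfl⟩
    exact rowEval_vecMul_charmatrix A u

end RowEval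

theorem sum_rationalBlock_smul {F V : Type*} [Field F] [AddCommGroup V] [Module F V] {m : ℕ}
    (a : Fin m → F) (w : ℕ → V) (hw : w m = ∑ t : Fin m, a t • w t) (t : Fin m) :
    ∑ s : Fin m, rationalBlock a t s • w s = w (t + 1) := by
  by_cases ht : (t : ℕ) + 1 = m
  · rw [ht, hw]
    refine Finset.sum_congr rfl fun s _ => ?_
    rw [rationalBlock, if_neg (by omega), if_pos (by omega)]
  · rw [Finset.sum_eq_single ⟨t + 1, by omega⟩]
    · simp [rationalBlock]
    · intro s _ hs
      rw [rationalBlock, if_neg fun h => hs (Fin.ext h), if_neg (by omega), zero_smul]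
    · simp

theorem linearIndependent_rowEval_of_smith {F ι κ : Type*} [Field F] [Fintype ι] [DecidableEq ι]
    [Fintype κ] [DecidableEq κ] {A : Matrix ι ι F} {P Q : Matrix ι ι F[X]} {d : ι → F[X]}
    (hP : IsUnit P) (hQ : IsUnit Q) (hPQ : P * charmatrix A * Q = diagonal d)
    (pos : κ → ι) (hpos : Function.Injective pos) (k : κ → ℕ)
    (hd : ∀ j, (d (pos j)).degree = k j) :
    LinearIndependent F fun s : Σ j, Fin (k j) =>
      rowEval A ((X ^ (s.2 : ℕ) : F[X]) • Q⁻¹ (pos s.1)) := by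
  rw [Matrix.isUnit_iff_isUnit_det] at hP hQ
  rw [Fintype.linearIndependent_iff]
  rintro c hc ⟨j, t⟩
  set p : κ → F[X] := fun j => ∑ t : Fin (k j), C (c ⟨j, t⟩) * X ^ (t : ℕ) with hp
  have hsum : rowEval A (∑ j, p j • Q⁻¹ (pos j)) = 0 := by
    rw [← hc, Fintype.sum_sigma, map_sum]
    refine Finset.sum_congr rfl fun j _ => ?_
    rw [hp, Finset.sum_smul, map_sum]
    refine Finset.sum_congr rfl fun t _ => ?_
    rw [← map_smul, mul_smul]
    congr 1
    ext1 l
    simp [smul_eq_C_mul]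
  obtain ⟨u, hu⟩ := (rowEval_eq_zero_iff A _).1 hsum
  have hdiag : (u ᵥ* P⁻¹) ᵥ* diagonal d = ∑ j, p j • Pi.single (pos j) 1 := by
    rw [← hPQ, vecMul_vecMul, ← mul_assoc, ← mul_assoc, nonsing_inv_mul _ hP, one_mul,
      ← vecMul_vecMul, hu, Matrix.sum_vecMul]
    refine Finset.sum_congr rfl fun j _ => ?_
    rw [smul_vecMul]
    congr 1
    ext1 l
    calc (Q⁻¹ (pos j) ᵥ* Q) l = (Q⁻¹ * Q) (pos j) l := rfl
      _ = (Pi.single (pos j) 1 : ι → F[X]) l := by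
        rw [nonsing_inv_mul _ hQ, Matrix.one_apply, Pi.single_apply]
        simp only [eq_comm]
  have hdvd : d (pos j) ∣ p j := by
    have h := congrFun hdiag (pos j)
    rw [vecMul_diagonal, Finset.sum_apply, Finset.sum_eq_single j] at h
    · rw [Pi.smul_apply, Pi.single_eq_same, smul_eq_mul, mul_one] at h
      exact ⟨_, (h.symm.trans (mul_comm _ _))⟩
    · intro i _ hi
      simp [hpos.ne hi.symm]
    · simp
  have hzero : p j = 0 :=
    eq_zero_of_dvd_of_degree_lt hdvd ((degree_sum_fin_lt _).trans_eq (hd j).symm)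
  have := congrArg (fun q => coeff q t) hzero
  simpa [hp, coeff_X_pow, Fin.val_inj] using this

theorem rowEval_smith_mul {F ι κ : Type*} [Field F] [Fintype ι] [DecidableEq ι]
    [Fintype κ] [DecidableEq κ] {A : Matrix ι ι F} {P Q : Matrix ι ι F[X]} {d : ι → F[X]}
    (hQ : IsUnit Q) (hPQ : P * charmatrix A * Q = diagonal d)
    (pos : κ → ι) (k : κ → ℕ) (a : ∀ j, Fin (k j) → F)
    (hd : ∀ j, d (pos j) = X ^ k j - ∑ t : Fin (k j), C (a j t) * X ^ (t : ℕ)) :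
    Matrix.of (fun s : Σ j, Fin (k j) =>
      rowEval A ((X ^ (s.2 : ℕ) : F[X]) • Q⁻¹ (pos s.1))) * A =
    blockDiagonal' (fun j => rationalBlock (a j)) * Matrix.of (fun s : Σ j, Fin (k j) =>
      rowEval A ((X ^ (s.2 : ℕ) : F[X]) • Q⁻¹ (pos s.1))) := by
  rw [Matrix.isUnit_iff_isUnit_det] at hQ
  have hrel (j : κ) : rowEval A (d (pos j) • Q⁻¹ (pos j)) = 0 := by
    refine (rowEval_eq_zero_iff A _).2 ⟨P (pos j), ?_⟩
    have h : P * charmatrix A = diagonal d * Q⁻¹ := by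
      rw [← hPQ, mul_nonsing_inv_cancel_right _ _ hQ]
    ext1 l
    refine (congrFun (congrFun h (pos j)) l).trans ?_
    rw [diagonal_mul, Pi.smul_apply, smul_eq_mul]
  ext ⟨j, t⟩ l
  set w : ℕ → ι → F := fun m => rowEval A ((X ^ m : F[X]) • Q⁻¹ (pos j)) with hw
  have hlast : w (k j) = ∑ t : Fin (k j), a j t • w t := by
    have h := hrel j
    rw [hd, sub_smul, map_sub, sub_eq_zero, Finset.sum_smul, map_sum] at h
    rw [hw]
    refine h.trans (Finset.sum_congr rfl fun t _ => ?_)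
    rw [← map_smul, mul_smul]
    congr 1
    ext1 l
    simp [smul_eq_C_mul]
  have hnext : w (t + 1) = w t ᵥ* A := by
    simp only [hw]
    rw [pow_succ', mul_smul, rowEval_X_smul]
  have h := congrFun (sum_rationalBlock_smul (a j) w hlast t) l
  rw [hnext] at h
  rw [Matrix.mul_apply, Matrix.mul_apply, Fintype.sum_sigma, Finset.sum_eq_single j]
  · simp only [blockDiagonal'_apply_eq, Matrix.of_apply]
    rw [Finset.sum_apply] at h
    exact h.symm
  · intro i _ hi
    exact Finset.sum_eq_zero fun s _ => by
      rw [blockDiagonal'_apply_ne _ _ _ hi.symm, zero_mul]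
  · simp

/-- **Theorem 2.** If the characteristic matrix `λE - A` of `A ∈ Mₙ(F)` can be brought,
by multiplication on the left and right by matrices invertible over `F[λ]`, to the diagonal
matrix whose first `n - r` diagonal entries are `1` and whose last `r` diagonal entries are
the monic polynomials `gᵢ(λ) = λ^{nᵢ} - a_{i,nᵢ-1} λ^{nᵢ-1} - ⋯ - a_{i,1} λ - a_{i,0}`
(with `n₁ + ⋯ + nᵣ = n`), then `A` is similar over `F` to the block diagonal matrix
`diag(T₁, …, Tᵣ)`, where `Tᵢ` is the `nᵢ × nᵢ` matrix with `1` on the superdiagonal,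
last row `(a_{i,0}, …, a_{i,nᵢ-1})`, and `0` elsewhere. -/
theorem rational_form_of_smith_form
    {F : Type*} [Field F] {n : ℕ} (hn : 0 < n) (A : Matrix (Fin n) (Fin n) F)
    (r : ℕ) (k : Fin r → ℕ) (hk : ∀ i, 0 < k i) (hsum : ∑ i, k i = n)
    (a : (i : Fin r) → Fin (k i) → F)
    (P Q : Matrix (Fin n) (Fin n) F[X])
    (hP : IsUnit P) (hQ : IsUnit Q)
    (d : Fin n → F[X])
    (hd1 : ∀ i : Fin n, (i : ℕ) < n - r → d i = 1)
    (hd2 : ∀ j : Fin r, ∀ i : Fin n, (i : ℕ) = n - r + (j : ℕ) →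
      d i = X ^ (k j) - ∑ t : Fin (k j), C (a j t) * X ^ (t : ℕ))
    (hPQ : P * charmatrix A * Q = Matrix.diagonal d) :
    ∃ e : (Σ i : Fin r, Fin (k i)) ≃ Fin n,
      ∃ S : Matrix (Fin n) (Fin n) F, IsUnit S ∧
        A = S * (Matrix.reindex e e
          (Matrix.blockDiagonal' (fun i => rationalBlock (a i)))) * S⁻¹ := by
  have hr : r ≤ n := by
    have h : ∑ _i : Fin r, 1 ≤ ∑ i, k i := Finset.sum_le_sum fun i _ => hk i
    simpa [hsum] using h
  let pos : Fin r → Fin n := fun j => ⟨n - r + j, by omega⟩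
  have hpos : Function.Injective pos := fun i j h => by
    have := congrArg Fin.val h
    simp only [pos] at this
    omega
  have hd (j : Fin r) := hd2 j (pos j) rfl
  have hdeg (j : Fin r) : (d (pos j)).degree = k j := by
    rw [hd, degree_sub_eq_left_of_degree_lt, degree_X_pow]
    rw [degree_X_pow]
    exact degree_sum_fin_lt _
  let e : (Σ i : Fin r, Fin (k i)) ≃ Fin n := Fintype.equivFinOfCardEq (by simp [hsum])
  set W : Matrix (Σ i : Fin r, Fin (k i)) (Fin n) F := Matrix.of fun s =>
    rowEval A ((X ^ (s.2 : ℕ) : F[X]) • Q⁻¹ (pos s.1))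
  have hli : LinearIndependent F W.row :=
    linearIndependent_rowEval_of_smith hP hQ hPQ pos hpos k hdeg
  have hmul : W * A = blockDiagonal' (fun i => rationalBlock (a i)) * W :=
    rowEval_smith_mul hQ hPQ pos k a hd
  have hunit : IsUnit (W.submatrix e.symm id) :=
    linearIndependent_rows_iff_isUnit.1 (hli.comp _ e.symm.injective)
  have hdet := (Matrix.isUnit_iff_isUnit_det _).1 hunit
  refine ⟨e, (W.submatrix e.symm id)⁻¹, (isUnit_nonsing_inv_iff).2 hunit, ?_⟩
  rw [nonsing_inv_nonsing_inv _ hdet, reindex_apply, mul_assoc,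
    submatrix_mul_equiv _ _ _ e.symm, ← hmul]
  rw [show (W * A).submatrix e.symm id = W.submatrix e.symm id * A from rfl,
    nonsing_inv_mul_cancel_left _ _ hdet]
end

section
/- Let F be a field and A an n×n matrix over F (n ≥ 1). Then there exist monic polynomials g₁, …, g_r ∈ F[λ] of degrees n₁, …, n_r ≥ 1 with n₁+⋯+n_r = n such that A is similar over F to the block diagonal matrix diag(T₁, …, T_r), where T_i is the n_i×n_i matrix with 1 on the superdiagonal, last row given by the coefficients of g_i (namely, writing g_i(λ) = λ^{n_i} − a_{i,n_i−1}λ^{n_i−1} − ⋯ − a_{i,0}, the last row of T_i is (a_{i,0}, …, a_{i,n_i−1})), and 0 elsewhere; i.e., every square matrix over a field is similar to a rational canonical form. -/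
open Polynomial Matrix

/-- The "rational block" of size `m` attached to a polynomial `g`:
`1` on the superdiagonal, last row `(a 0, a 1, …, a (m-1))` where
`a j = -(coeff of λ^j in g)` (so that writing
`g(λ) = λ^m - a_{m-1} λ^{m-1} - ⋯ - a_1 λ - a_0` the last row is
`(a_0, …, a_{m-1})`), and `0` elsewhere (a transposed companion matrix of `g`). -/
def rationalBlockOf {F : Type*} [Field F] (g : Polynomial F) (m : ℕ) :
    Matrix (Fin m) (Fin m) F :=
  fun i j => if (j : ℕ) = (i : ℕ) + 1 then 1
    else if (i : ℕ) = m - 1 then -(g.coeff (j : ℕ)) else 0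

open Module

section RationalCanonicalForm

universe u

variable {F : Type u} [Field F]

theorem pow_natDegree_eq_sum_of_aeval_eq_zero {R : Type*} [CommRing R] [Algebra F R]
    {g : F[X]} (hg : g.Monic) {a : R} (ha : aeval a g = 0) :
    a ^ g.natDegree = ∑ y : Fin g.natDegree, (-g.coeff y) • a ^ (y : ℕ) := by
  rw [hg.as_sum] at ha
  simp only [map_add, map_pow, aeval_X, map_sum, map_mul, aeval_C] at ha
  rw [eq_neg_of_add_eq_zero_left ha, Finset.sum_range, ← Finset.sum_neg_distrib]
  simp [Algebra.smul_def]

/-- The rational block of `g` describes multiplication by a root of `g` on its powers. -/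
theorem mul_pow_eq_sum_rationalBlockOf {R : Type*} [CommRing R] [Algebra F R]
    {g : F[X]} (hg : g.Monic) {a : R} (ha : aeval a g = 0) (x : Fin g.natDegree) :
    a * a ^ (x : ℕ) = ∑ y, rationalBlockOf g g.natDegree x y • a ^ (y : ℕ) := by
  rw [← pow_succ']
  by_cases hx : (x : ℕ) + 1 < g.natDegree
  · rw [Finset.sum_eq_single ⟨x + 1, hx⟩]
    · simp [rationalBlockOf]
    · intro y _ hy
      have h₁ : (y : ℕ) ≠ x + 1 := fun h => hy (Fin.ext h)
      have h₂ : (x : ℕ) ≠ g.natDegree - 1 := by omega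
      simp [rationalBlockOf, h₁, h₂]
    · simp
  · have hx' : (x : ℕ) + 1 = g.natDegree := by omega
    rw [hx', pow_natDegree_eq_sum_of_aeval_eq_zero hg ha]
    refine Finset.sum_congr rfl fun y _ => ?_
    have h₁ : (y : ℕ) ≠ x + 1 := by omega
    have h₂ : (x : ℕ) = g.natDegree - 1 := by omega
    simp only [rationalBlockOf, if_neg h₁, if_pos h₂]

/-- A cyclic torsion module over `F[X]` has a basis on which `X` acts through a
rational block. -/
theorem exists_basis_quotient_span_singleton {q : F[X]} (hq : q ≠ 0) :
    ∃ (g : F[X]) (c : Basis (Fin g.natDegree) F (F[X] ⧸ Submodule.span F[X] {q})), g.Monic ∧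
      ∀ x, (X : F[X]) • c x = ∑ y, rationalBlockOf g g.natDegree x y • c y := by
  have hu : IsUnit (C q.leadingCoeff⁻¹) :=
    isUnit_C.2 (inv_ne_zero (leadingCoeff_ne_zero.2 hq)).isUnit
  have hspan : Submodule.span F[X] {q} = Ideal.span {q * C q.leadingCoeff⁻¹} :=
    (Ideal.span_singleton_mul_right_unit hu q).symm
  have hg : (q * C q.leadingCoeff⁻¹).Monic := monic_mul_leadingCoeff_inv hq
  rw [hspan]
  refine ⟨_, (AdjoinRoot.powerBasis' hg).basis, hg, fun x => ?_⟩
  have key := mul_pow_eq_sum_rationalBlockOf hg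
    (by rw [AdjoinRoot.aeval_eq, AdjoinRoot.mk_self] :
      aeval (AdjoinRoot.root (q * C q.leadingCoeff⁻¹)) (q * C q.leadingCoeff⁻¹) = 0) x
  have hc (y : Fin (q * C q.leadingCoeff⁻¹).natDegree) :
      (AdjoinRoot.powerBasis' hg).basis y = AdjoinRoot.root _ ^ (y : ℕ) :=
    (AdjoinRoot.powerBasis' hg).basis_eq_pow y
  simp only [← hc] at key
  exact key

/-- An endomorphism of a finite-dimensional space acts through a direct sum of rational blocks
on a suitable basis. -/
theorem exists_basis_rationalBlockOf {V : Type*} [AddCommGroup V] [Module F V]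
    [FiniteDimensional F V] (f : V →ₗ[F] V) :
    ∃ (ι : Type u) (_ : Fintype ι) (g : ι → F[X])
      (b : Basis (Σ i, Fin (g i).natDegree) F V), (∀ i, (g i).Monic) ∧
      ∀ i x, f (b ⟨i, x⟩) = ∑ y, rationalBlockOf (g i) (g i).natDegree x y • b ⟨i, y⟩ := by
  classical
  obtain ⟨ι, _, p, hp, e, ⟨φ⟩⟩ := equiv_directSum_of_isTorsion
    (AEval.isTorsion_of_finiteDimensional F V f)
  choose g c hg hc using fun i =>
    exists_basis_quotient_span_singleton (pow_ne_zero (e i) (hp i).ne_zero)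
  let ψ := φ.trans (DirectSum.linearEquivFunOnFintype F[X] ι
    fun i => F[X] ⧸ Submodule.span F[X] {p i ^ e i})
  let b := (Pi.basis c).map ((AEval'.of f).trans (ψ.restrictScalars F)).symm
  have hb (i x) : b ⟨i, x⟩ = (AEval'.of f).symm (ψ.symm (Pi.single i (c i x))) := by
    simp [b, Pi.basis_apply]
  refine ⟨ι, inferInstance, g, b, hg, fun i x => ?_⟩
  apply ((AEval'.of f).trans (ψ.restrictScalars F)).injective
  have hf (v : V) : ψ (AEval'.of f (f v)) = (X : F[X]) • ψ (AEval'.of f v) := by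
    rw [← AEval'.X_smul_of, map_smul]
  have hbi (y) : ((AEval'.of f).trans (ψ.restrictScalars F)) (b ⟨i, y⟩) =
      LinearMap.single F _ i (c i y) := by
    simp [hb]
  simp only [map_sum, map_smul, hbi]
  simp only [← map_smul, ← map_sum, ← hc]
  refine (hf _).trans ?_
  rw [hb]
  simpa using (Pi.single_smul (f := fun i => F[X] ⧸ Submodule.span F[X] {p i ^ e i})
    i (X : F[X]) (c i x)).symm

/-- Discarding the empty fibres of a sigma type over a finite index type. -/
theorem exists_equiv_sigma_fin_of_pos {ι : Type*} [Fintype ι] (k : ι → ℕ) :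
    ∃ (r : ℕ) (σ : Fin r → ι) (e : (Σ j, Fin (k (σ j))) ≃ Σ i, Fin (k i)),
      (∀ j, 1 ≤ k (σ j)) ∧ ∀ j x, e ⟨j, x⟩ = ⟨σ j, x⟩ := by
  classical
  let τ := (Fintype.equivFin {i // 1 ≤ k i}).symm
  refine ⟨_, fun j => (τ j : ι),
    Equiv.ofBijective (fun s => ⟨(τ s.1 : ι), s.2⟩) ⟨?_, ?_⟩, fun j => (τ j).2, fun _ _ => rfl⟩
  · exact Function.Injective.sigma_map (β₂ := fun i => Fin (k i))
      (Subtype.val_injective.comp τ.injective) fun _ => Function.injective_id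
  · rintro ⟨i, x⟩
    obtain ⟨j, hj⟩ := τ.surjective ⟨i, by have := x.2; omega⟩
    obtain rfl : (τ j : ι) = i := congrArg Subtype.val hj
    exact ⟨⟨j, x⟩, rfl⟩

end RationalCanonicalForm

/-- Every square matrix over a field is similar to a rational canonical form: there
are monic polynomials `g₁, …, gᵣ` of degrees `n₁, …, nᵣ ≥ 1` with `n₁ + ⋯ + nᵣ = n`
such that `A` is similar to `diag(T₁, …, Tᵣ)`, where `Tᵢ` is the transposed companion
matrix of `gᵢ`. -/
theorem exists_rational_canonical_form
    {F : Type*} [Field F] {n : ℕ} (hn : 1 ≤ n)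
    (A : Matrix (Fin n) (Fin n) F) :
    ∃ (r : ℕ) (g : Fin r → Polynomial F) (k : Fin r → ℕ),
      (∀ i, (g i).Monic) ∧ (∀ i, (g i).natDegree = k i) ∧ (∀ i, 1 ≤ k i) ∧
      ∑ i, k i = n ∧
      ∃ e : (Σ i : Fin r, Fin (k i)) ≃ Fin n,
        ∃ S : Matrix (Fin n) (Fin n) F, IsUnit S ∧
          A = S * (Matrix.reindex e e
            (Matrix.blockDiagonal' (fun i => rationalBlockOf (g i) (k i)))) * S⁻¹ := by
  obtain ⟨ι, _, g, b, hg, hb⟩ := exists_basis_rationalBlockOf A.vecMulLinear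
  obtain ⟨r, σ, e₀, hσ, he₀⟩ := exists_equiv_sigma_fin_of_pos fun i => (g i).natDegree
  let c := b.reindex e₀.symm
  have hc (j x) : c ⟨j, x⟩ = b ⟨σ j, x⟩ := by simp [c, he₀]
  have hcard : ∑ j, (g (σ j)).natDegree = n := by
    simpa using (Module.finrank_eq_card_basis c).symm
  let e : (Σ j, Fin (g (σ j)).natDegree) ≃ Fin n := Fintype.equivFinOfCardEq (by simpa using hcard)
  refine ⟨r, fun j => g (σ j), fun j => (g (σ j)).natDegree, fun j => hg _, fun _ => rfl, hσ,
    hcard, e, ?_⟩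
  let P : Matrix (Fin n) (Fin n) F := Matrix.of (c.reindex e)
  have hP : IsUnit P :=
    Matrix.linearIndependent_rows_iff_isUnit.1 (c.reindex e).linearIndependent
  have hdet : IsUnit P.det := (Matrix.isUnit_iff_isUnit_det P).1 hP
  refine ⟨P⁻¹, (Matrix.isUnit_nonsing_inv_iff).2 hP, ?_⟩
  have hPA : P * A = Matrix.reindex e e
      (Matrix.blockDiagonal' fun j => rationalBlockOf (g (σ j)) (g (σ j)).natDegree) * P := by
    ext s t
    obtain ⟨⟨j, x⟩, rfl⟩ := e.surjective s
    have hrow (u) : P (e u) = c u := by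
      change (c.reindex e) (e u) = c u
      simp
    rw [Matrix.mul_apply_eq_vecMul, hrow, hc, Matrix.mul_apply, ← e.sum_comp, Fintype.sum_sigma,
      Finset.sum_eq_single j]
    · simpa [hrow, hc, Matrix.blockDiagonal'_apply_eq] using congrFun (hb (σ j) x) t
    · intro j' _ hj'
      simp [Matrix.blockDiagonal'_apply_ne _ _ _ hj'.symm]
    · simp
  rw [Matrix.nonsing_inv_nonsing_inv _ hdet, Matrix.mul_assoc, ← hPA,
    Matrix.nonsing_inv_mul_cancel_left _ _ hdet]
end
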